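/- arXiv:1803.08224 — 2 statements merged into one kernel-verified Lean document; each statement's English description precedes it below -/
import Mathlib

section
/- For the Euclidean ball ρB₂ⁿ of radius ρ > 0 in ℝ^n, the Ulam floating body M_δ(ρB₂ⁿ) is a ball with the same center, and the difference Δ(ρ,δ) of radii of ρB₂ⁿ and M_δ(ρB₂ⁿ) satisfies lim_{δ→0⁺} Δ(ρ,δ)/δ^{2/(n+1)} = (1/2)·((n+1)/(n+3))·((n+1)/|B₂^{n-1}|)^{2/(n+1)}·ρ^{-(n-1)/(n+1)}, where |B₂^{n-1}| is the volume of the (n-1)-dimensional Euclidean unit ball. -/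
open MeasureTheory Metric Set
open scoped RealInnerProductSpace ENNReal Topology

noncomputable def metronoid {n : ℕ} (μ : Measure (EuclideanSpace ℝ (Fin n))) :
    Set (EuclideanSpace ℝ (Fin n)) :=
  {z | ∃ f : EuclideanSpace ℝ (Fin n) → ℝ,
    (∀ y, 0 ≤ f y ∧ f y ≤ 1) ∧ Integrable f μ ∧ (∫ y, f y ∂μ) = 1 ∧
    Integrable (fun y => f y • y) μ ∧ z = ∫ y, f y • y ∂μ}

/-- The Ulam floating body `M_δ(K)`. -/
noncomputable def ulam {n : ℕ} (K : Set (EuclideanSpace ℝ (Fin n))) (δ : ℝ) :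
    Set (EuclideanSpace ℝ (Fin n)) :=
  metronoid ((volume.restrict K).withDensity fun _ => ENNReal.ofReal (1 / δ))

/-- `Δ(ρ,δ)`: the difference between `ρ` and the radius of `M_δ(ρB₂ⁿ)`. -/
noncomputable def ulamBallGap (n : ℕ) (ρ δ : ℝ) : ℝ :=
  ρ - sSup ((fun x => ‖x‖) ''
    ulam (Metric.closedBall (0 : EuclideanSpace ℝ (Fin n)) ρ) δ)



noncomputable def uOmega (m : ℕ) : ℝ :=
  (volume (Metric.ball (0 : EuclideanSpace ℝ (Fin m)) 1)).toReal

noncomputable def uPhi (m : ℕ) (ρ x : ℝ) : ℝ := (√(x * (2 * ρ - x))) ^ m * uOmega m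

theorem u_vol_tail (m : ℕ) (r : ℝ) (hr : 0 ≤ r) :
    volume {z : Fin m → ℝ | ∑ i, z i ^ 2 ≤ r} = ENNReal.ofReal ((√r) ^ m * uOmega m) := by
  have h := (PiLp.volume_preserving_ofLp (Fin m)).measure_preimage
    (s := {z : Fin m → ℝ | ∑ i, z i ^ 2 ≤ r})
    (measurableSet_le (by fun_prop) (by fun_prop)).nullMeasurableSet
  rw [← h]
  have : (WithLp.ofLp ⁻¹' {z : Fin m → ℝ | ∑ i, z i ^ 2 ≤ r} : Set (EuclideanSpace ℝ (Fin m)))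
      = closedBall 0 (√r) := by
    ext y
    simp only [mem_preimage, mem_ofPred_eq, mem_closedBall, dist_zero_right, EuclideanSpace.norm_eq,
      Real.norm_eq_abs, sq_abs]
    rw [Real.sqrt_le_sqrt_iff hr]
  rw [this, Measure.addHaar_closedBall _ _ (Real.sqrt_nonneg _), uOmega,
    ENNReal.ofReal_mul (by positivity), ENNReal.ofReal_toReal measure_ball_lt_top.ne]
  simp

theorem u_slice (m : ℕ) (ρ : ℝ) (hρ : 0 < ρ) (u : EuclideanSpace ℝ (Fin (m+1))) (hu : ‖u‖ = 1) :
    Measure.map (fun y => ρ - ⟪u, y⟫) (volume.restrict (closedBall (0 : EuclideanSpace ℝ (Fin (m+1))) ρ)) =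
    (volume.restrict (Icc 0 (2 * ρ))).withDensity (fun x => ENNReal.ofReal (uPhi m ρ x)) := by
  obtain ⟨b, hb⟩ := Orthonormal.exists_orthonormalBasis_extension_of_card_eq (𝕜 := ℝ)
    (E := EuclideanSpace ℝ (Fin (m+1))) (ι := Fin (m+1)) (by simp) (v := fun _ => u) (s := {0})
    (by
      constructor
      · intro i; simpa using hu
      · intro i j hij; exact absurd (Subsingleton.elim i j) hij)
  have hb0 : b 0 = u := hb 0 rfl
  ext s hs
  rw [Measure.map_apply (by fun_prop) hs, withDensity_apply _ hs,
    Measure.restrict_apply (hs.preimage (by fun_prop))]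
  let T : Set (ℝ × (Fin m → ℝ)) := {p | ρ - p.1 ∈ s ∧ ∑ i, p.2 i ^ 2 ≤ ρ ^ 2 - p.1 ^ 2}
  have hT : MeasurableSet T := by
    apply MeasurableSet.inter
    · exact hs.preimage (f := fun p : ℝ × (Fin m → ℝ) => ρ - p.1) (by fun_prop)
    · exact measurableSet_le (f := fun p : ℝ × (Fin m → ℝ) => ∑ i, p.2 i ^ 2) (g := fun p => ρ ^ 2 - p.1 ^ 2) (by fun_prop) (by fun_prop)
  have hmp := (((volume_preserving_piFinSuccAbove (fun _ : Fin (m+1) => ℝ) 0).comp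
    (PiLp.volume_preserving_ofLp (Fin (m+1)))).comp b.repr.measurePreserving)
  have h1 := hmp.measure_preimage hT.nullMeasurableSet
  have h2 : ((fun y => ρ - ⟪u, y⟫) ⁻¹' s ∩ closedBall (0 : EuclideanSpace ℝ (Fin (m+1))) ρ) =
     (((MeasurableEquiv.piFinSuccAbove (fun _ : Fin (m+1) => ℝ) 0) ∘ WithLp.ofLp) ∘ b.repr) ⁻¹' T := by
    ext y
    simp only [T, mem_inter_iff, mem_preimage, mem_closedBall, dist_zero_right, mem_ofPred_eq, Function.comp]
    have e1 : ‖y‖ ≤ ρ ↔ ‖b.repr y‖ ^ 2 ≤ ρ ^ 2 := by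
      rw [b.repr.norm_map, sq_le_sq₀ (norm_nonneg _) hρ.le]
    have e2 : ⟪u, y⟫ = b.repr y 0 := by rw [b.repr_apply_apply, hb0]
    rw [e1, e2, EuclideanSpace.norm_sq_eq, Fin.sum_univ_succ]
    simp only [MeasurableEquiv.piFinSuccAbove_apply, Fin.insertNthEquiv_symm_apply]
    simp only [Real.norm_eq_abs, sq_abs, Fin.removeNth, Fin.zero_succAbove, le_sub_iff_add_le']
  rw [h2, h1]
  change (Measure.prod volume volume) T = _
  rw [Measure.prod_apply hT, Measure.restrict_restrict hs]
  rw [← lintegral_sub_left_eq_self _ ρ, ← lintegral_indicator (hs.inter measurableSet_Icc)]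
  congr 1
  ext x
  by_cases hx : x ∈ s ∩ Icc 0 (2 * ρ)
  · rw [indicator_of_mem hx, uPhi, ← u_vol_tail]
    · congr 1
      ext z
      simp only [T, mem_preimage, mem_ofPred_eq, sub_sub_cancel, hx.1, true_and]
      ring_nf
    · exact mul_nonneg hx.2.1 (by linarith [hx.2.2])
  · rw [indicator_of_notMem hx]
    convert measure_empty (μ := (volume : Measure (Fin m → ℝ)))
    ext z
    simp only [T, mem_preimage, mem_ofPred_eq, sub_sub_cancel, mem_empty_iff_false, iff_false, not_and, not_le]
    intro hs'
    have h0 : 0 ≤ ∑ i, z i ^ 2 := by positivity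
    refine lt_of_lt_of_le ?_ h0
    by_contra hc
    push Not at hc
    apply hx
    refine ⟨hs', ?_, ?_⟩ <;> nlinarith

theorem uPhi_cont (m : ℕ) (ρ : ℝ) : Continuous (uPhi m ρ) := by
  unfold uPhi; fun_prop

theorem uPhi_nonneg (m : ℕ) (ρ x : ℝ) : 0 ≤ uPhi m ρ x := by
  unfold uPhi uOmega; positivity

noncomputable def uMu (n : ℕ) (ρ δ : ℝ) : Measure (EuclideanSpace ℝ (Fin n)) :=
  (volume.restrict (closedBall 0 ρ)).withDensity fun _ => ENNReal.ofReal (1 / δ)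

noncomputable def uV (m : ℕ) (ρ ε : ℝ) : ℝ := ∫ x in (0)..ε, uPhi m ρ x
noncomputable def uG (m : ℕ) (ρ ε : ℝ) : ℝ := ∫ x in (0)..ε, x * uPhi m ρ x

theorem uMu_eq (n : ℕ) (ρ δ : ℝ) :
    uMu n ρ δ = ENNReal.ofReal (1 / δ) • (volume.restrict (closedBall 0 ρ)) := by
  rw [uMu, withDensity_const]

instance uMu_fin (n : ℕ) (ρ δ : ℝ) : IsFiniteMeasure (uMu n ρ δ) := by
  rw [uMu_eq]
  have : IsFiniteMeasure (volume.restrict (closedBall (0 : EuclideanSpace ℝ (Fin n)) ρ)) :=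
    ⟨by simpa using measure_closedBall_lt_top⟩
  exact Measure.smul_finite _ ENNReal.ofReal_ne_top

theorem uMu_int (n : ℕ) (ρ δ : ℝ) : Integrable (fun y => y) (uMu n ρ δ) := by
  rw [uMu_eq]
  apply Integrable.smul_measure _ ENNReal.ofReal_ne_top
  exact continuous_id.continuousOn.integrableOn_compact (isCompact_closedBall _ _)

theorem uMu_push (m : ℕ) (ρ δ : ℝ) (hρ : 0 < ρ) (hδ : 0 < δ)
    (u : EuclideanSpace ℝ (Fin (m+1))) (hu : ‖u‖ = 1) (g : ℝ → ℝ) (hg : Measurable g) :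
    ∫ y, g (ρ - ⟪u, y⟫) ∂(uMu (m+1) ρ δ) = (∫ x in Icc 0 (2 * ρ), uPhi m ρ x * g x) / δ := by
  rw [uMu_eq, integral_smul_measure, ← integral_map (φ := fun y => ρ - ⟪u, y⟫) (f := g)
    (by fun_prop) hg.aestronglyMeasurable, u_slice m ρ hρ u hu,
    integral_withDensity_eq_integral_toReal_smul
      ((uPhi_cont m ρ).measurable.ennreal_ofReal) (by simp)]
  simp only [ENNReal.toReal_ofReal (uPhi_nonneg m ρ _), smul_eq_mul]
  rw [ENNReal.toReal_ofReal (by positivity)]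
  ring

theorem uMu_ind (m : ℕ) (ρ δ ε : ℝ) (hρ : 0 < ρ) (hδ : 0 < δ) (hε : 0 ≤ ε) (hε' : ε ≤ 2 * ρ)
    (u : EuclideanSpace ℝ (Fin (m+1))) (hu : ‖u‖ = 1) (g : ℝ → ℝ) (hg : Measurable g) :
    ∫ y, (Iic ε).indicator g (ρ - ⟪u, y⟫) ∂(uMu (m+1) ρ δ) =
      (∫ x in (0)..ε, uPhi m ρ x * g x) / δ := by
  rw [uMu_push m ρ δ hρ hδ u hu _ (hg.indicator measurableSet_Iic)]
  congr 1
  have : (fun x => uPhi m ρ x * (Iic ε).indicator g x) =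
      (Iic ε).indicator (fun x => uPhi m ρ x * g x) := by
    ext x
    by_cases hx : x ∈ Iic ε <;> simp [hx]
  rw [this, setIntegral_indicator measurableSet_Iic, intervalIntegral.integral_of_le hε,
    ← integral_Icc_eq_integral_Ioc]
  congr 2
  ext x
  simp only [mem_inter_iff, mem_Icc, mem_Iic]
  constructor
  · rintro ⟨⟨a, b⟩, c⟩; exact ⟨a, c⟩
  · rintro ⟨a, b⟩; exact ⟨⟨a, by linarith⟩, b⟩

section
variable {m : ℕ} {ρ δ ε : ℝ}

noncomputable def uCap (ρ ε : ℝ) (u : EuclideanSpace ℝ (Fin (m+1)))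
    (y : EuclideanSpace ℝ (Fin (m+1))) : ℝ := (Iic ε).indicator (fun _ => 1) (ρ - ⟪u, y⟫)

theorem uCap_meas (u : EuclideanSpace ℝ (Fin (m+1))) : Measurable (uCap ρ ε u) := by
  unfold uCap
  exact (measurable_const.indicator measurableSet_Iic).comp (by fun_prop)

theorem uCap_bd (u y : EuclideanSpace ℝ (Fin (m+1))) : 0 ≤ uCap ρ ε u y ∧ uCap ρ ε u y ≤ 1 := by
  unfold uCap
  by_cases h : ρ - ⟪u, y⟫ ∈ Iic ε
  · rw [indicator_of_mem h]; norm_num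
  · rw [indicator_of_notMem h]; norm_num

theorem uCap_int (u : EuclideanSpace ℝ (Fin (m+1))) : Integrable (uCap ρ ε u) (uMu (m+1) ρ δ) := by
  refine Integrable.of_bound (uCap_meas u).aestronglyMeasurable 1 (Filter.Eventually.of_forall ?_)
  intro y
  rw [Real.norm_eq_abs, abs_le]
  constructor <;> linarith [(uCap_bd (ρ := ρ) (ε := ε) u y).1, (uCap_bd (ρ := ρ) (ε := ε) u y).2]

theorem u_smul_int (f : EuclideanSpace ℝ (Fin (m+1)) → ℝ) (hf : ∀ y, 0 ≤ f y ∧ f y ≤ 1)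
    (hi : Integrable f (uMu (m+1) ρ δ)) : Integrable (fun y => f y • y) (uMu (m+1) ρ δ) := by
  refine (uMu_int (m+1) ρ δ).mono (hi.aestronglyMeasurable.smul (by fun_prop))
    (Filter.Eventually.of_forall ?_)
  intro y
  rw [norm_smul, Real.norm_eq_abs, abs_of_nonneg (hf y).1]
  exact mul_le_of_le_one_left (norm_nonneg _) (hf y).2

theorem uCap_one (hρ : 0 < ρ) (hδ : 0 < δ) (hε : 0 ≤ ε) (hε' : ε ≤ 2 * ρ)
    (hV : uV m ρ ε = δ) (u : EuclideanSpace ℝ (Fin (m+1))) (hu : ‖u‖ = 1) :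
    ∫ y, uCap ρ ε u y ∂(uMu (m+1) ρ δ) = 1 := by
  unfold uCap
  rw [uMu_ind m ρ δ ε hρ hδ hε hε' u hu _ measurable_const]
  simp only [mul_one]
  rw [← uV, hV, div_self hδ.ne']

theorem u_inner (u : EuclideanSpace ℝ (Fin (m+1)))
    (f : EuclideanSpace ℝ (Fin (m+1)) → ℝ) (hf : ∀ y, 0 ≤ f y ∧ f y ≤ 1)
    (hi : Integrable f (uMu (m+1) ρ δ)) (h1 : ∫ y, f y ∂(uMu (m+1) ρ δ) = 1) :
    Integrable (fun y => f y * (ρ - ⟪u, y⟫)) (uMu (m+1) ρ δ) ∧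
    ∫ y, f y * (ρ - ⟪u, y⟫) ∂(uMu (m+1) ρ δ) = ρ - ⟪u, ∫ y, f y • y ∂(uMu (m+1) ρ δ)⟫ := by
  have hs := u_smul_int f hf hi
  have e : (fun y => f y * (ρ - ⟪u, y⟫)) = fun y => ρ * f y - ⟪u, f y • y⟫ := by
    ext y; rw [inner_smul_right]; ring
  have i1 : Integrable (fun y => ρ * f y) (uMu (m+1) ρ δ) := hi.const_mul ρ
  have i2 : Integrable (fun y => ⟪u, f y • y⟫) (uMu (m+1) ρ δ) := hs.const_inner u
  rw [e]
  refine ⟨i1.sub i2, ?_⟩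
  rw [integral_sub i1 i2, integral_const_mul, h1, integral_inner hs]
  ring

theorem uCap_inner (hρ : 0 < ρ) (hδ : 0 < δ) (hε : 0 ≤ ε) (hε' : ε ≤ 2 * ρ)
    (u : EuclideanSpace ℝ (Fin (m+1))) (hu : ‖u‖ = 1) :
    ∫ y, uCap ρ ε u y * (ρ - ⟪u, y⟫) ∂(uMu (m+1) ρ δ) = uG m ρ ε / δ := by
  have := uMu_ind m ρ δ ε hρ hδ hε hε' u hu (fun x => x) measurable_id
  simp only [uG, mul_comm _ (uPhi m ρ _)]
  rw [← this]
  congr 1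
  ext y
  unfold uCap
  by_cases h : ρ - ⟪u, y⟫ ∈ Iic ε
  · simp only [indicator_of_mem h, one_mul]
  · simp only [indicator_of_notMem h, zero_mul]

theorem u_bath (hρ : 0 < ρ) (hδ : 0 < δ) (hε : 0 ≤ ε) (hε' : ε ≤ 2 * ρ)
    (hV : uV m ρ ε = δ) (u : EuclideanSpace ℝ (Fin (m+1))) (hu : ‖u‖ = 1)
    (f : EuclideanSpace ℝ (Fin (m+1)) → ℝ) (hf : ∀ y, 0 ≤ f y ∧ f y ≤ 1)
    (hi : Integrable f (uMu (m+1) ρ δ)) (h1 : ∫ y, f y ∂(uMu (m+1) ρ δ) = 1) :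
    ⟪u, ∫ y, f y • y ∂(uMu (m+1) ρ δ)⟫ ≤ ρ - uG m ρ ε / δ := by
  obtain ⟨if1, ef1⟩ := u_inner u f hf hi h1
  have hc1 := uCap_one hρ hδ hε hε' hV u hu
  have hci : Integrable (uCap ρ ε u) (uMu (m+1) ρ δ) := uCap_int u
  obtain ⟨ic1, ec1⟩ := u_inner u _ (uCap_bd (ρ := ρ) (ε := ε) u) hci hc1
  have ec2 := uCap_inner (m := m) hρ hδ hε hε' u hu
  have key : ∫ y, (uCap ρ ε u y * (ρ - ⟪u, y⟫) + ε * f y) ∂(uMu (m+1) ρ δ) ≤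
      ∫ y, (f y * (ρ - ⟪u, y⟫) + ε * uCap ρ ε u y) ∂(uMu (m+1) ρ δ) := by
    apply integral_mono (ic1.add (hi.const_mul ε)) (if1.add (hci.const_mul ε))
    intro y
    simp only [Pi.add_apply]
    obtain ⟨a, b⟩ := hf y
    by_cases h : ρ - ⟪u, y⟫ ∈ Iic ε
    · have : uCap ρ ε u y = 1 := by unfold uCap; rw [indicator_of_mem h]
      rw [this]
      have h' : ρ - ⟪u, y⟫ ≤ ε := h
      nlinarith
    · have : uCap ρ ε u y = 0 := by unfold uCap; rw [indicator_of_notMem h]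
      rw [this]
      have h' : ε < ρ - ⟪u, y⟫ := not_le.mp h
      nlinarith
  rw [integral_add ic1 (hi.const_mul ε), integral_add if1 (hci.const_mul ε), integral_const_mul,
    integral_const_mul, h1, hc1, ec2, ef1] at key
  linarith

theorem u_norm_le (hρ : 0 < ρ) (hδ : 0 < δ) (hε : 0 ≤ ε) (hε' : ε ≤ 2 * ρ)
    (hV : uV m ρ ε = δ) 
    (f : EuclideanSpace ℝ (Fin (m+1)) → ℝ) (hf : ∀ y, 0 ≤ f y ∧ f y ≤ 1)
    (hi : Integrable f (uMu (m+1) ρ δ)) (h1 : ∫ y, f y ∂(uMu (m+1) ρ δ) = 1) :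
    ‖∫ y, f y • y ∂(uMu (m+1) ρ δ)‖ ≤ ρ - uG m ρ ε / δ := by
  set z := ∫ y, f y • y ∂(uMu (m+1) ρ δ) with hz
  by_cases h0 : z = 0
  · have a := u_bath hρ hδ hε hε' hV (EuclideanSpace.single 0 1) (by simp) f hf hi h1
    rw [← hz, h0, inner_zero_right] at a
    rwa [h0, norm_zero]
  · have hn : ‖z‖ ≠ 0 := norm_ne_zero_iff.mpr h0
    have a := u_bath hρ hδ hε hε' hV (‖z‖⁻¹ • z) (by
      rw [norm_smul, norm_inv, norm_norm, inv_mul_cancel₀ hn]) f hf hi h1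
    rw [← hz, real_inner_smul_left, real_inner_self_eq_norm_sq] at a
    have : ‖z‖⁻¹ * ‖z‖ ^ 2 = ‖z‖ := by field_simp
    rwa [this] at a

theorem uCap_bary (hρ : 0 < ρ) (hδ : 0 < δ) (hε : 0 ≤ ε) (hε' : ε ≤ 2 * ρ)
    (hV : uV m ρ ε = δ) (u : EuclideanSpace ℝ (Fin (m+1))) (hu : ‖u‖ = 1) :
    ∫ y, uCap ρ ε u y • y ∂(uMu (m+1) ρ δ) = (ρ - uG m ρ ε / δ) • u := by
  have hc1 := uCap_one hρ hδ hε hε' hV u hu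
  have hci : Integrable (uCap ρ ε u) (uMu (m+1) ρ δ) := uCap_int u
  have hb := u_norm_le hρ hδ hε hε' hV _ (uCap_bd (ρ := ρ) (ε := ε) u) hci hc1
  obtain ⟨ic1, ec1⟩ := u_inner u _ (uCap_bd (ρ := ρ) (ε := ε) u) hci hc1
  rw [uCap_inner (m := m) hρ hδ hε hε' u hu] at ec1
  set z := ∫ y, uCap ρ ε u y • y ∂(uMu (m+1) ρ δ)
  set h := ρ - uG m ρ ε / δ
  have e : ⟪u, z⟫ = h := by simp only [h]; linarith
  have : ‖z - h • u‖ ^ 2 ≤ 0 := by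
    rw [norm_sub_sq_real, real_inner_smul_right, real_inner_comm, e, norm_smul, hu,
      Real.norm_eq_abs, mul_one, sq_abs]
    nlinarith [norm_nonneg z]
  have h2 : ‖z - h • u‖ = 0 := by
    have := le_antisymm this (sq_nonneg _)
    exact pow_eq_zero_iff (two_ne_zero) |>.mp this
  exact sub_eq_zero.mp (norm_eq_zero.mp h2)

theorem u_ball (hρ : 0 < ρ) (hδ : 0 < δ) (hε : 0 ≤ ε) (hε' : ε ≤ 2 * ρ)
    (hV : uV m ρ ε = δ) : 0 ≤ ρ - uG m ρ ε / δ ∧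
    ulam (closedBall (0 : EuclideanSpace ℝ (Fin (m+1))) ρ) δ = closedBall 0 (ρ - uG m ρ ε / δ) := by
  have hR : 0 ≤ ρ - uG m ρ ε / δ := by
    have hu : ‖(EuclideanSpace.single 0 1 : EuclideanSpace ℝ (Fin (m+1)))‖ = 1 := by simp
    exact (norm_nonneg _).trans (u_norm_le hρ hδ hε hε' hV _ (uCap_bd (ρ := ρ) (ε := ε) _)
      (uCap_int _) (uCap_one hρ hδ hε hε' hV _ hu))
  refine ⟨hR, ?_⟩
  set R := ρ - uG m ρ ε / δ with hRdef
  ext z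
  rw [mem_closedBall, dist_zero_right]
  constructor
  · rintro ⟨f, hf, hi, h1, -, rfl⟩
    exact u_norm_le hρ hδ hε hε' hV f hf hi h1
  · intro hz
    obtain ⟨u, hu, hzu⟩ : ∃ u : EuclideanSpace ℝ (Fin (m+1)), ‖u‖ = 1 ∧ z = ‖z‖ • u := by
      by_cases h0 : z = 0
      · exact ⟨EuclideanSpace.single 0 1, by simp, by simp [h0]⟩
      · have hn : ‖z‖ ≠ 0 := norm_ne_zero_iff.mpr h0
        refine ⟨‖z‖⁻¹ • z, ?_, ?_⟩
        · rw [norm_smul, norm_inv, norm_norm, inv_mul_cancel₀ hn]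
        · rw [smul_smul, mul_inv_cancel₀ hn, one_smul]
    obtain ⟨a, ha0, ha1, haz⟩ : ∃ a : ℝ, 0 ≤ a ∧ a ≤ 1 ∧ ‖z‖ = a * R - (1 - a) * R := by
      rcases hR.eq_or_lt with h | h
      · refine ⟨0, le_rfl, zero_le_one, ?_⟩
        have := norm_nonneg z
        rw [← h] at hz ⊢
        linarith
      · refine ⟨(1 + ‖z‖ / R) / 2, by positivity, ?_, ?_⟩
        · have := (div_le_one h).mpr hz
          linarith
        · field_simp; ring
    have hu' : ‖-u‖ = 1 := by rwa [norm_neg]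
    have i1 : Integrable (uCap ρ ε u) (uMu (m+1) ρ δ) := uCap_int u
    have i2 : Integrable (uCap ρ ε (-u)) (uMu (m+1) ρ δ) := uCap_int (-u)
    have hf : ∀ y, 0 ≤ a * uCap ρ ε u y + (1 - a) * uCap ρ ε (-u) y ∧
        a * uCap ρ ε u y + (1 - a) * uCap ρ ε (-u) y ≤ 1 := by
      intro y
      obtain ⟨b1, b2⟩ := uCap_bd (ρ := ρ) (ε := ε) u y
      obtain ⟨c1, c2⟩ := uCap_bd (ρ := ρ) (ε := ε) (-u) y
      constructor <;> nlinarith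
    have hi : Integrable (fun y => a * uCap ρ ε u y + (1 - a) * uCap ρ ε (-u) y)
      (uMu (m+1) ρ δ) := (i1.const_mul a).add (i2.const_mul (1 - a))
    refine ⟨fun y => a * uCap ρ ε u y + (1 - a) * uCap ρ ε (-u) y, hf, hi, ?_,
      u_smul_int _ hf hi, ?_⟩
    · change ∫ y, _ ∂(uMu (m+1) ρ δ) = 1
      rw [integral_add (i1.const_mul a) (i2.const_mul (1 - a)), integral_const_mul,
        integral_const_mul, uCap_one hρ hδ hε hε' hV u hu, uCap_one hρ hδ hε hε' hV _ hu']
      ring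
    · change z = ∫ y, _ ∂(uMu (m+1) ρ δ)
      simp only [add_smul, mul_smul]
      rw [integral_add, integral_smul, integral_smul, uCap_bary hρ hδ hε hε' hV u hu,
        uCap_bary hρ hδ hε hε' hV _ hu', hzu, haz, ← hRdef]
      · module
      · exact (u_smul_int _ (uCap_bd u) i1).smul a
      · exact (u_smul_int _ (uCap_bd (-u)) i2).smul (1 - a)

theorem u_gap (hρ : 0 < ρ) (hδ : 0 < δ) (hε : 0 ≤ ε) (hε' : ε ≤ 2 * ρ)
    (hV : uV m ρ ε = δ) : ulamBallGap (m+1) ρ δ = uG m ρ ε / δ := by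
  obtain ⟨hR, h⟩ := u_ball hρ hδ hε hε' hV
  unfold ulamBallGap
  rw [h]
  set R := ρ - uG m ρ ε / δ with hRdef
  have : IsGreatest ((fun x => ‖x‖) '' closedBall (0 : EuclideanSpace ℝ (Fin (m+1))) R) R := by
    constructor
    · refine ⟨EuclideanSpace.single 0 R, ?_, ?_⟩ <;> simp [abs_of_nonneg hR]
    · rintro _ ⟨x, hx, rfl⟩
      simpa using hx
  rw [this.csSup_eq, hRdef]
  ring

theorem u_total (hρ : 0 < ρ) :
    (volume (closedBall (0 : EuclideanSpace ℝ (Fin (m+1))) ρ)).toReal = uV m ρ (2 * ρ) := by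
  have h := uMu_push m ρ 1 hρ one_pos (EuclideanSpace.single 0 1) (by simp) (fun _ => 1)
    measurable_const
  rw [uMu_eq] at h
  simp only [mul_one, div_one, ENNReal.ofReal_one, one_smul, integral_const, smul_eq_mul,
    Measure.real, Measure.restrict_apply_univ] at h
  rw [h, uV, intervalIntegral.integral_of_le (by positivity), integral_Icc_eq_integral_Ioc]

theorem u_exists (hρ : 0 < ρ) (hδ : 0 < δ)
    (h : δ < (volume (closedBall (0 : EuclideanSpace ℝ (Fin (m+1))) ρ)).toReal) :
    ∃ ε, 0 < ε ∧ ε ≤ 2 * ρ ∧ uV m ρ ε = δ := by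
  rw [u_total hρ] at h
  have hc : Continuous (uV m ρ) :=
    intervalIntegral.continuous_primitive (fun a b => (uPhi_cont m ρ).intervalIntegrable a b) 0
  have h0 : uV m ρ 0 = 0 := by simp [uV]
  obtain ⟨ε, he, hV⟩ := intermediate_value_Icc (by positivity : 0 ≤ 2 * ρ) hc.continuousOn
    (show δ ∈ Icc (uV m ρ 0) (uV m ρ (2 * ρ)) by rw [h0]; exact ⟨hδ.le, h.le⟩)
  refine ⟨ε, lt_of_le_of_ne he.1 ?_, he.2, hV⟩
  rintro rfl
  rw [h0] at hV
  exact hδ.ne hV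

end

section
open Filter

theorem uOmega_pos (m : ℕ) : 0 < uOmega m :=
  ENNReal.toReal_pos (measure_ball_pos _ _ one_pos).ne' measure_ball_lt_top.ne

theorem u_pow_int (p ε : ℝ) (hp : 0 ≤ p) : ∫ x in (0)..ε, x ^ p = ε ^ (p + 1) / (p + 1) := by
  rw [integral_rpow (Or.inl (by linarith)), Real.zero_rpow (by linarith), sub_zero]

theorem u_phi_fac (m k : ℕ) (ρ x : ℝ) (hx : 0 ≤ x) :
    x ^ k * uPhi m ρ x = (uOmega m * √(2 * ρ - x) ^ m) * x ^ ((m : ℝ) / 2 + k) := by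
  have : √x ^ m = x ^ ((m : ℝ) / 2) := by
    rw [Real.sqrt_eq_rpow, ← Real.rpow_natCast, ← Real.rpow_mul hx]
    ring_nf
  rw [Real.rpow_add_of_nonneg hx (by positivity) (by positivity), Real.rpow_natCast, ← this, uPhi,
    Real.sqrt_mul hx]
  ring

theorem u_asym (m k : ℕ) (ρ : ℝ) (hρ : 0 < ρ) :
    Tendsto (fun ε : ℝ => (∫ x in (0)..ε, x ^ k * uPhi m ρ x) / ε ^ ((m : ℝ) / 2 + k + 1))
      (𝓝[>] 0) (𝓝 ((uOmega m * √(2 * ρ) ^ m) / ((m : ℝ) / 2 + k + 1))) := by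
  have hω := uOmega_pos m
  have hp : (0 : ℝ) ≤ (m : ℝ) / 2 + k := by positivity
  have hev : ∀ᶠ ε : ℝ in 𝓝[>] 0, 0 < ε ∧ ε < ρ := Ioo_mem_nhdsGT hρ
  have hint : ∀ ε : ℝ, IntervalIntegrable (fun x => x ^ k * uPhi m ρ x) volume 0 ε := fun ε =>
    ((continuous_pow k).mul (uPhi_cont m ρ)).intervalIntegrable _ _
  have hint2 : ∀ c ε : ℝ, IntervalIntegrable (fun x => c * x ^ ((m : ℝ) / 2 + k)) volume 0 ε :=
    fun c ε => (intervalIntegral.intervalIntegrable_rpow' (by linarith)).const_mul c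
  refine tendsto_of_tendsto_of_tendsto_of_le_of_le'
    (g := fun ε => (uOmega m * √(2 * ρ - ε) ^ m) / ((m : ℝ) / 2 + k + 1))
    (h := fun ε => (uOmega m * √(2 * ρ) ^ m) / ((m : ℝ) / 2 + k + 1)) ?_ tendsto_const_nhds ?_ ?_
  · have : Continuous (fun ε : ℝ => (uOmega m * √(2 * ρ - ε) ^ m) / ((m : ℝ) / 2 + k + 1)) := by
      fun_prop
    have h := (this.tendsto 0).mono_left (nhdsWithin_le_nhds (s := Ioi 0))
    simpa using h
  · filter_upwards [hev] with ε hε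
    rw [le_div_iff₀ (Real.rpow_pos_of_pos hε.1 _), div_mul_eq_mul_div, mul_div_assoc,
      ← u_pow_int _ _ hp, ← intervalIntegral.integral_const_mul]
    apply intervalIntegral.integral_mono_on hε.1.le (hint2 _ _) (hint _)
    intro x hx
    rw [u_phi_fac m k ρ x hx.1]
    have := Real.rpow_nonneg hx.1 ((m : ℝ) / 2 + k)
    gcongr
    exact hx.2
  · filter_upwards [hev] with ε hε
    rw [div_le_iff₀ (Real.rpow_pos_of_pos hε.1 _), div_mul_eq_mul_div, mul_div_assoc,
      ← u_pow_int _ _ hp, ← intervalIntegral.integral_const_mul]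
    apply intervalIntegral.integral_mono_on hε.1.le (hint _) (hint2 _ _)
    intro x hx
    rw [u_phi_fac m k ρ x hx.1]
    have := Real.rpow_nonneg hx.1 ((m : ℝ) / 2 + k)
    gcongr
    linarith [hx.1]

theorem u_const (m : ℕ) (ρ w : ℝ) (hρ : 0 < ρ) (hw : 0 < w) (q : ℝ) (hq : q * ((m : ℝ) / 2 + 1) = 1) :
    (w * √(2 * ρ) ^ m) / ((m : ℝ) / 2 + 2) / ((w * √(2 * ρ) ^ m) / ((m : ℝ) / 2 + 1) *
      ((w * √(2 * ρ) ^ m) / ((m : ℝ) / 2 + 1)) ^ q) =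
    (1 / 2) * (((m : ℝ) + 2) / (m + 4)) * (((m : ℝ) + 2) / w) ^ q * ρ ^ (-((m : ℝ) / (m + 2))) := by
  have h2 : √(2 * ρ) ^ m = (2 * ρ) ^ ((m : ℝ) / 2) := by
    rw [Real.sqrt_eq_rpow, ← Real.rpow_natCast, ← Real.rpow_mul (by positivity)]
    ring_nf
  have hqm : q * ((m : ℝ) / 2) = 1 - q := by linarith
  have hq' : q = 2 / (m + 2) := by field_simp; linarith
  have hm : (m : ℝ) / (m + 2) = 1 - q := by rw [hq']; field_simp; ring
  have e1 : ((w * √(2 * ρ) ^ m) / ((m : ℝ) / 2 + 1)) ^ q =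
      2 * ρ ^ (1 - q) / ((((m : ℝ) + 2) / w) ^ q) := by
    have : (w * √(2 * ρ) ^ m) / ((m : ℝ) / 2 + 1) = 2 * (2 * ρ) ^ ((m : ℝ) / 2) / (((m : ℝ) + 2) / w) := by
      rw [h2]; field_simp
    rw [this, Real.div_rpow (by positivity) (by positivity),
      Real.mul_rpow (by positivity) (by positivity), ← Real.rpow_mul (by positivity), mul_comm _ q, hqm,
      Real.mul_rpow (by positivity) (by positivity), ← mul_assoc, ← Real.rpow_add two_pos]
    norm_num
  rw [e1, hm, Real.rpow_neg hρ.le]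
  have h3 : 0 < √(2 * ρ) ^ m := by positivity
  have h4 : 0 < (((m : ℝ) + 2) / w) ^ q := by positivity
  have h5 : 0 < ρ ^ (1 - q) := by positivity
  generalize √(2 * ρ) ^ m = A at *
  generalize (((m : ℝ) + 2) / w) ^ q = B at *
  generalize ρ ^ (1 - q) = C at *
  field_simp
  ring

theorem u_limit (m : ℕ) (ρ : ℝ) (hρ : 0 < ρ) (q : ℝ) (hq : q * ((m : ℝ) / 2 + 1) = 1) :
    Tendsto (fun ε : ℝ => uG m ρ ε / uV m ρ ε / (uV m ρ ε) ^ q) (𝓝[>] 0)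
      (𝓝 ((1 / 2) * (((m : ℝ) + 2) / (m + 4)) * (((m : ℝ) + 2) / uOmega m) ^ q *
        ρ ^ (-((m : ℝ) / (m + 2))))) := by
  have hω := uOmega_pos m
  rw [← u_const m ρ _ hρ hω q hq]
  have t0 := u_asym m 0 ρ hρ
  have t1 := u_asym m 1 ρ hρ
  simp only [pow_zero, one_mul, pow_one, Nat.cast_zero, Nat.cast_one, add_zero] at t0 t1
  have e2 : (m : ℝ) / 2 + 1 + 1 = (m : ℝ) / 2 + 2 := by ring
  rw [e2] at t1
  have hc : 0 < (uOmega m * √(2 * ρ) ^ m) / ((m : ℝ) / 2 + 1) := by positivity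
  have t2 := t1.div (t0.mul (t0.rpow_const (p := q) (Or.inl hc.ne'))) (by positivity)
  refine t2.congr' ?_
  filter_upwards [self_mem_nhdsWithin, t0.eventually (lt_mem_nhds hc)] with ε hε hV
  have hε : 0 < ε := hε
  have hp : 0 < ε ^ ((m : ℝ) / 2 + 1) := Real.rpow_pos_of_pos hε _
  change 0 < uV m ρ ε / _ at hV
  have hV' : 0 < uV m ρ ε := (div_pos_iff_of_pos_right hp).mp hV
  change uG m ρ ε / _ / (uV m ρ ε / _ * (uV m ρ ε / _) ^ q) = _
  rw [Real.div_rpow hV'.le hp.le, ← Real.rpow_mul hε.le, mul_comm _ q, hq, Real.rpow_one, ← e2,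
    Real.rpow_add_one hε.ne' ((m : ℝ) / 2 + 1)]
  have h4 : 0 < uV m ρ ε ^ q := Real.rpow_pos_of_pos hV' _
  field_simp

theorem uV_mono (m : ℕ) (ρ a b : ℝ) (ha : 0 ≤ a) (hab : a ≤ b) : uV m ρ a ≤ uV m ρ b := by
  unfold uV
  apply intervalIntegral.integral_mono_interval le_rfl ha hab
  · exact Eventually.of_forall (fun x => uPhi_nonneg m ρ x)
  · exact (uPhi_cont m ρ).intervalIntegrable _ _

theorem uV_pos (m : ℕ) (ρ η : ℝ) (hρ : 0 < ρ) (hη : 0 < η) : 0 < uV m ρ η := by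
  have hω := uOmega_pos m
  have t0 := u_asym m 0 ρ hρ
  simp only [pow_zero, one_mul, Nat.cast_zero, add_zero] at t0
  have hc : 0 < (uOmega m * √(2 * ρ) ^ m) / ((m : ℝ) / 2 + 1) := by positivity
  obtain ⟨ε, hV, hε⟩ := ((t0.eventually (lt_mem_nhds hc)).and (Ioo_mem_nhdsGT hη)).exists
  have hp : 0 < ε ^ ((m : ℝ) / 2 + 1) := Real.rpow_pos_of_pos hε.1 _
  have hV' : 0 < uV m ρ ε := (div_pos_iff_of_pos_right hp).mp hV
  exact hV'.trans_le (uV_mono m ρ _ _ hε.1.le hε.2.le)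

theorem u_main (m : ℕ) (ρ : ℝ) (hρ : 0 < ρ) (q : ℝ) (hq : q * ((m : ℝ) / 2 + 1) = 1) :
    Tendsto (fun δ : ℝ => ulamBallGap (m + 1) ρ δ / δ ^ q) (𝓝[>] 0)
      (𝓝 ((1 / 2) * (((m : ℝ) + 2) / (m + 4)) * (((m : ℝ) + 2) / uOmega m) ^ q *
        ρ ^ (-((m : ℝ) / (m + 2))))) := by
  have hex : ∀ δ : ℝ, ∃ ε : ℝ, 0 < δ →
      δ < (volume (closedBall (0 : EuclideanSpace ℝ (Fin (m+1))) ρ)).toReal →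
      0 < ε ∧ ε ≤ 2 * ρ ∧ uV m ρ ε = δ := by
    intro δ
    by_cases h : 0 < δ ∧ δ < (volume (closedBall (0 : EuclideanSpace ℝ (Fin (m+1))) ρ)).toReal
    · obtain ⟨ε, h'⟩ := u_exists hρ h.1 h.2
      exact ⟨ε, fun _ _ => h'⟩
    · exact ⟨0, fun a b => absurd ⟨a, b⟩ h⟩
  choose e he using hex
  have hB : 0 < (volume (closedBall (0 : EuclideanSpace ℝ (Fin (m+1))) ρ)).toReal := by
    rw [u_total hρ]; exact uV_pos m ρ _ hρ (by positivity)
  have hev : ∀ᶠ δ : ℝ in 𝓝[>] 0, 0 < δ ∧ 0 < e δ ∧ e δ ≤ 2 * ρ ∧ uV m ρ (e δ) = δ := by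
    filter_upwards [Ioo_mem_nhdsGT hB] with δ hδ
    exact ⟨hδ.1, he δ hδ.1 hδ.2⟩
  have ht : Tendsto e (𝓝[>] 0) (𝓝[>] 0) := by
    rw [tendsto_nhdsWithin_iff]
    refine ⟨?_, hev.mono fun δ h => h.2.1⟩
    rw [Metric.tendsto_nhds]
    intro η hη
    filter_upwards [hev, Ioo_mem_nhdsGT (uV_pos m ρ η hρ hη)] with δ h hδ
    rw [Real.dist_eq, sub_zero, abs_of_pos h.2.1]
    by_contra hc
    push Not at hc
    have := uV_mono m ρ _ _ hη.le hc
    rw [h.2.2.2] at this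
    exact absurd hδ.2 (not_lt.mpr this)
  refine ((u_limit m ρ hρ q hq).comp ht).congr' ?_
  filter_upwards [hev] with δ h
  simp only [Function.comp]
  rw [h.2.2.2, u_gap hρ h.1 h.2.1.le h.2.2.1 h.2.2.2]

end

/-- `M_δ(ρB₂ⁿ)` is a concentric ball of radius `ρ - Δ(ρ,δ)`, and
`Δ(ρ,δ)/δ^{2/(n+1)} → (1/2)((n+1)/(n+3))((n+1)/|B₂^{n-1}|)^{2/(n+1)} ρ^{-(n-1)/(n+1)}`
as `δ → 0⁺`. -/
theorem stmt14 (n : ℕ) (hn : 1 ≤ n) (ρ : ℝ) (hρ : 0 < ρ) :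
    (∀ δ : ℝ, 0 < δ →
      δ < (volume (Metric.closedBall (0 : EuclideanSpace ℝ (Fin n)) ρ)).toReal →
      ulam (Metric.closedBall (0 : EuclideanSpace ℝ (Fin n)) ρ) δ =
        Metric.closedBall 0 (ρ - ulamBallGap n ρ δ)) ∧
    Filter.Tendsto (fun δ : ℝ => ulamBallGap n ρ δ / δ ^ ((2 : ℝ) / (n + 1)))
      (𝓝[>] 0)
      (𝓝 ((1 / 2) * ((n + 1) / (n + 3)) *
        ((n + 1) / (volume (Metric.ball (0 : EuclideanSpace ℝ (Fin (n - 1))) 1)).toReal)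
          ^ ((2 : ℝ) / (n + 1)) * ρ ^ (-(((n : ℝ) - 1) / (n + 1))))) := by
  obtain ⟨m, rfl⟩ : ∃ m, n = m + 1 := ⟨n - 1, by omega⟩
  constructor
  · intro δ hδ hδ'
    obtain ⟨ε, h0, h1, hV⟩ := u_exists hρ hδ hδ'
    rw [u_gap hρ hδ h0.le h1 hV]
    exact (u_ball hρ hδ h0.le h1 hV).2
  · have h := u_main m ρ hρ (2 / (((m + 1 : ℕ) : ℝ) + 1)) (by push_cast; field_simp; ring)
    convert h using 2
    rw [uOmega]
    have e1 : ((m + 1 : ℕ) : ℝ) + 1 = m + 2 := by push_cast; ring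
    have e2 : ((m + 1 : ℕ) : ℝ) + 3 = m + 4 := by push_cast; ring
    have e3 : ((m + 1 : ℕ) : ℝ) - 1 = m := by push_cast; ring
    rw [e1, e2, e3]
end

section
/- Let K ⊆ ℝ^n be a convex body with 0 ∈ ∂K such that N_K(0) = -e_n is the unique outer unit normal to K at 0, and let φ: K → (0,∞) be continuous. For t > 0 set H_t⁺ = {y : ⟨y,e_n⟩ ≤ t}. Then for each t > 0 there exists r > 0 such that for all δ > 0, M_δ(K,φ) ∩ B₂ⁿ(0,r) = M_δ(K ∩ H_t⁺, φ) ∩ B₂ⁿ(0,r). -/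
open MeasureTheory Metric Set
open scoped RealInnerProductSpace ENNReal Topology

/-- The weighted Ulam floating body `M_δ(K, φ)`. -/
noncomputable def ulamW {n : ℕ} (K : Set (EuclideanSpace ℝ (Fin n)))
    (φ : EuclideanSpace ℝ (Fin n) → ℝ) (δ : ℝ) : Set (EuclideanSpace ℝ (Fin n)) :=
  metronoid ((volume.restrict K).withDensity fun x => ENNReal.ofReal (φ x / δ))


theorem sep_aux {n : ℕ} (hn : 1 ≤ n) {s : Set (EuclideanSpace ℝ (Fin n))} (hs : Convex ℝ s)
    {z : EuclideanSpace ℝ (Fin n)} (hz : z ∉ s) :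
    ∃ θ : EuclideanSpace ℝ (Fin n), ‖θ‖ = 1 ∧ ∀ w ∈ s, ⟪w, θ⟫ ≤ ⟪z, θ⟫ := by
  have : Nonempty (Fin n) := ⟨⟨0, hn⟩⟩
  have : Nontrivial (EuclideanSpace ℝ (Fin n)) := inferInstance
  rcases s.eq_empty_or_nonempty with rfl | hne
  · obtain ⟨θ, hθ⟩ := exists_norm_eq (EuclideanSpace ℝ (Fin n)) (zero_le_one (α := ℝ))
    exact ⟨θ, hθ, by simp⟩
  suffices h : ∃ θ : EuclideanSpace ℝ (Fin n), θ ≠ 0 ∧ ∀ w ∈ s, ⟪w, θ⟫ ≤ ⟪z, θ⟫ by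
    obtain ⟨θ, h1, h2⟩ := h
    have hp : 0 < ‖θ‖ := norm_pos_iff.2 h1
    refine ⟨‖θ‖⁻¹ • θ, ?_, fun w hw => ?_⟩
    · rw [norm_smul, norm_inv, norm_norm, inv_mul_cancel₀ hp.ne']
    · rw [inner_smul_right, inner_smul_right]
      exact mul_le_mul_of_nonneg_left (h2 w hw) (by positivity)
  have key : ∀ f : StrongDual ℝ (EuclideanSpace ℝ (Fin n)), f ≠ 0 → (∀ w ∈ s, f w ≤ f z) →
      ∃ θ : EuclideanSpace ℝ (Fin n), θ ≠ 0 ∧ ∀ w ∈ s, ⟪w, θ⟫ ≤ ⟪z, θ⟫ := by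
    intro f hf h
    refine ⟨(InnerProductSpace.toDual ℝ _).symm f, by simpa using hf, fun w hw => ?_⟩
    rw [real_inner_comm, real_inner_comm _ z, InnerProductSpace.toDual_symm_apply,
      InnerProductSpace.toDual_symm_apply]
    exact h w hw
  by_cases hi : (interior s).Nonempty
  · obtain ⟨f, hf0, hf⟩ := geometric_hahn_banach_of_nonempty_interior_point hs
      (fun h => hz (interior_subset h)) hi
    exact key f hf0 hf
  · rw [hs.interior_nonempty_iff_affineSpan_eq_top] at hi
    by_cases hza : z ∈ affineSpan ℝ s
    · have hd : (affineSpan ℝ s).direction ≠ ⊤ := by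
        intro h
        exact hi ((AffineSubspace.direction_eq_top_iff_of_nonempty ⟨z, hza⟩).1 h)
      have hd2 : (affineSpan ℝ s).directionᗮ ≠ ⊥ := by
        intro h; exact hd (by rwa [Submodule.orthogonal_eq_bot_iff] at h)
      obtain ⟨θ, hθ, hθ0⟩ := Submodule.exists_mem_ne_zero_of_ne_bot hd2
      refine ⟨θ, hθ0, fun w hw => ?_⟩
      have := (Submodule.mem_orthogonal _ _).1 hθ (w -ᵥ z)
        (AffineSubspace.vsub_mem_direction (subset_affineSpan ℝ s hw) hza)
      rw [vsub_eq_sub, inner_sub_left] at this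
      linarith
    · obtain ⟨f, u, h1, h2⟩ := geometric_hahn_banach_closed_point (affineSpan ℝ s).convex
        (AffineSubspace.closed_of_finiteDimensional _) hza
      refine key f ?_ (fun w hw => ((h1 w (subset_affineSpan ℝ s hw)).trans h2).le)
      rintro rfl
      obtain ⟨w, hw⟩ := hne
      have := (h1 w (subset_affineSpan ℝ s hw)).trans h2
      simp at this

theorem intg_aux {n : ℕ} {μ : Measure (EuclideanSpace ℝ (Fin n))}
    {D : ℝ} (hD : ∀ᵐ y ∂μ, ‖y‖ ≤ D) {f : EuclideanSpace ℝ (Fin n) → ℝ} (hf : Integrable f μ) :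
    Integrable (fun y => f y • y) μ :=
  hf.smul_bdd D aestronglyMeasurable_id hD

theorem inner_integral_aux {n : ℕ} {μ : Measure (EuclideanSpace ℝ (Fin n))}
    {f : EuclideanSpace ℝ (Fin n) → ℝ} (hf : Integrable (fun y => f y • y) μ)
    (θ : EuclideanSpace ℝ (Fin n)) :
    ⟪∫ y, f y • y ∂μ, θ⟫ = ∫ y, f y * ⟪y, θ⟫ ∂μ := by
  rw [real_inner_comm, ← integral_inner hf]
  congr 1; ext y
  rw [inner_smul_right, real_inner_comm]

theorem intg_inner_aux {n : ℕ} {μ : Measure (EuclideanSpace ℝ (Fin n))}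
    {f : EuclideanSpace ℝ (Fin n) → ℝ} (hf : Integrable (fun y => f y • y) μ)
    (θ : EuclideanSpace ℝ (Fin n)) : Integrable (fun y => f y * ⟪y, θ⟫) μ := by
  have := hf.const_inner (𝕜 := ℝ) θ
  refine this.congr (Filter.Eventually.of_forall fun y => ?_)
  simp only [inner_smul_right, real_inner_comm]

theorem metronoid_restrict_subset {n : ℕ} (μ : Measure (EuclideanSpace ℝ (Fin n)))
    {H : Set (EuclideanSpace ℝ (Fin n))} (hH : MeasurableSet H) :
    metronoid (μ.restrict H) ⊆ metronoid μ := by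
  rintro z ⟨f, h01, hi, h1, hi2, rfl⟩
  have e : (fun y => H.indicator f y • y) = H.indicator (fun y => f y • y) := by
    ext1 y; by_cases hy : y ∈ H <;> simp [hy]
  refine ⟨H.indicator f, fun y => ?_, (integrable_indicator_iff hH).2 hi, ?_, ?_, ?_⟩
  · by_cases hy : y ∈ H <;> simp [hy, h01 y]
  · rw [integral_indicator hH, h1]
  · rw [e]; exact (integrable_indicator_iff hH).2 hi2
  · rw [e, integral_indicator hH]

theorem metronoid_convex {n : ℕ} (μ : Measure (EuclideanSpace ℝ (Fin n))) :
    Convex ℝ (metronoid μ) := by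
  rintro _ ⟨f, f01, fi, f1, fi2, rfl⟩ _ ⟨g, g01, gi, g1, gi2, rfl⟩ a b ha hb hab
  have e : (fun y => (a * f y + b * g y) • y) = fun y => a • (f y • y) + b • (g y • y) := by
    ext1 y; rw [add_smul, mul_smul, mul_smul]
  refine ⟨fun y => a * f y + b * g y, fun y => ⟨?_, ?_⟩, ?_, ?_, ?_, ?_⟩
  · have := f01 y; have := g01 y; nlinarith [mul_nonneg ha (f01 y).1, mul_nonneg hb (g01 y).1]
  · nlinarith [mul_le_mul_of_nonneg_left (f01 y).2 ha, mul_le_mul_of_nonneg_left (g01 y).2 hb]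
  · exact (fi.const_mul a).add (gi.const_mul b)
  · rw [integral_add (fi.const_mul a) (gi.const_mul b), integral_const_mul, integral_const_mul,
      f1, g1]; linarith
  · rw [e]; exact (fi2.smul a).add (gi2.smul b)
  · rw [e, integral_add (f := fun y => a • (f y • y)) (g := fun y => b • (g y • y))
      (fi2.smul a) (gi2.smul b), integral_smul, integral_smul]

theorem far_aux {n : ℕ} {μ : Measure (EuclideanSpace ℝ (Fin n))} [IsFiniteMeasure μ]
    {D : ℝ} (hD : ∀ᵐ y ∂μ, ‖y‖ ≤ D) {H B : Set (EuclideanSpace ℝ (Fin n))}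
    (hB : MeasurableSet B) (hBH : B ⊆ H) (hB1 : 1 ≤ μ.real B)
    {θ : EuclideanSpace ℝ (Fin n)} {c : ℝ} (hc : ∀ y ∈ B, c ≤ ⟪y, θ⟫) :
    ∃ w ∈ metronoid (μ.restrict H), c ≤ ⟪w, θ⟫ := by
  have hp : 0 < μ.real B := by linarith
  set f : EuclideanSpace ℝ (Fin n) → ℝ := B.indicator fun _ => (μ.real B)⁻¹ with hf
  have hfi : Integrable f (μ.restrict H) := (integrable_const _).indicator hB
  have hfi2 := intg_aux (ae_restrict_of_ae hD) hfi
  have hr : (μ.restrict H).restrict B = μ.restrict B := by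
    rw [Measure.restrict_restrict hB, inter_eq_self_of_subset_left hBH]
  have h1 : ∫ y, f y ∂(μ.restrict H) = 1 := by
    rw [hf, integral_indicator hB, hr, setIntegral_const, smul_eq_mul, mul_inv_cancel₀ hp.ne']
  refine ⟨_, ⟨f, fun y => ?_, hfi, h1, hfi2, rfl⟩, ?_⟩
  · by_cases hy : y ∈ B
    · simp only [hf, hy, indicator_of_mem]; exact ⟨by positivity, inv_le_one_of_one_le₀ hB1⟩
    · simp [hf, hy]
  · rw [inner_integral_aux hfi2]
    calc c = ∫ y, f y * c ∂(μ.restrict H) := by rw [integral_mul_const, h1, one_mul]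
      _ ≤ _ := by
        refine integral_mono (hfi.mul_const c) (intg_inner_aux hfi2 θ) fun y => ?_
        by_cases hy : y ∈ B
        · simp only [hf, hy, indicator_of_mem]
          exact mul_le_mul_of_nonneg_left (hc y hy) (by positivity)
        · simp [hf, hy]

theorem near_aux {n : ℕ} {μ : Measure (EuclideanSpace ℝ (Fin n))} [IsFiniteMeasure μ]
    {D : ℝ} (hD : ∀ᵐ y ∂μ, ‖y‖ ≤ D) {H A : Set (EuclideanSpace ℝ (Fin n))}
    (hH : MeasurableSet H) (hA : MeasurableSet A) (hAH : A ⊆ H) (hA2 : 2 ≤ μ.real A)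
    {θ : EuclideanSpace ℝ (Fin n)} {a b : ℝ} (hab : b < a) (ha : ∀ y ∈ A, a ≤ ⟪y, θ⟫)
    (hb : ∀ᵐ y ∂(μ.restrict Hᶜ), ⟪y, θ⟫ ≤ b)
    {z : EuclideanSpace ℝ (Fin n)} (hz : z ∈ metronoid μ)
    (hmax : ∀ w ∈ metronoid (μ.restrict H), ⟪w, θ⟫ ≤ ⟪z, θ⟫) :
    z ∈ metronoid (μ.restrict H) := by
  obtain ⟨f, f01, fi, f1, fi2, rfl⟩ := hz
  set m := ∫ y in Hᶜ, f y ∂μ with hm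
  have hm0 : 0 ≤ m := integral_nonneg fun y => (f01 y).1
  have hsplit := integral_add_compl hH fi
  have hHf0 : 0 ≤ ∫ y in H, f y ∂μ := integral_nonneg fun y => (f01 y).1
  rw [f1, ← hm] at hsplit
  have fin := intg_inner_aux fi2 θ
  have hbm : ∫ y in Hᶜ, f y * ⟪y, θ⟫ ∂μ ≤ m * b := by
    rw [hm, ← integral_mul_const]
    refine integral_mono_ae fin.integrableOn (fi.integrableOn.mul_const b) ?_
    filter_upwards [hb] with y hy
    exact mul_le_mul_of_nonneg_left hy (f01 y).1
  have hsplit2 := integral_add_compl hH fin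
  -- the complementary mass in A
  have qi : Integrable (fun y => 1 - f y) μ := (integrable_const 1).sub fi
  set p := ∫ y in A, (1 - f y) ∂μ with hp
  have hp1 : 1 ≤ p := by
    have : p = μ.real A - ∫ y in A, f y ∂μ := by
      rw [hp, integral_sub (integrable_const 1) fi.integrableOn]; simp
    have h2 : ∫ y in A, f y ∂μ ≤ 1 := by
      rw [← f1]; exact setIntegral_le_integral fi (Filter.Eventually.of_forall fun y => (f01 y).1)
    linarith
  set l := m / p with hl
  have hlp : l * p = m := by rw [hl]; field_simp
  have hl0 : 0 ≤ l := by positivity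
  have hl1 : l ≤ 1 := by rw [hl, div_le_one (by linarith)]; linarith
  have hr : (μ.restrict H).restrict A = μ.restrict A := by
    rw [Measure.restrict_restrict hA, inter_eq_self_of_subset_left hAH]
  set q : EuclideanSpace ℝ (Fin n) → ℝ := A.indicator fun y => 1 - f y with hq
  have hqi : Integrable q (μ.restrict H) := (qi.restrict).indicator hA
  have hq01 : ∀ y, 0 ≤ q y ∧ f y + q y ≤ 1 := by
    intro y
    by_cases hy : y ∈ A
    · simp only [hq, hy, indicator_of_mem]; constructor <;> linarith [(f01 y).2]
    · simp [hq, hy, (f01 y).2]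
  have hgi : Integrable (fun y => f y + l * q y) (μ.restrict H) :=
    fi.restrict.add (hqi.const_mul l)
  have hgi2 := intg_aux (ae_restrict_of_ae hD) hgi
  have hqi2 := intg_aux (ae_restrict_of_ae hD) hqi
  have hqin := intg_inner_aux hqi2 θ
  have hqint : ∫ y, q y ∂(μ.restrict H) = p := by
    rw [hq, integral_indicator hA, hr]
  have hw := hmax _ ⟨fun y => f y + l * q y, fun y => by
    have h1 := hq01 y; have h2 := f01 y
    constructor
    · have := mul_nonneg hl0 h1.1; linarith
    · have := mul_le_mul_of_nonneg_right hl1 h1.1; linarith, hgi, by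
      rw [integral_add fi.restrict (hqi.const_mul l), integral_const_mul, hqint]; linarith,
      hgi2, rfl⟩
  rw [inner_integral_aux hgi2, inner_integral_aux fi2, ← hsplit2] at hw
  have e : (fun y => (f y + l * q y) * ⟪y, θ⟫) = fun y => f y * ⟪y, θ⟫ + l * (q y * ⟪y, θ⟫) := by
    ext1 y; ring
  rw [e, integral_add fin.restrict (hqin.const_mul l), integral_const_mul] at hw
  have hqa : p * a ≤ ∫ y in H, q y * ⟪y, θ⟫ ∂μ := by
    rw [← hqint, ← integral_mul_const]
    refine integral_mono (hqi.mul_const a) hqin fun y => ?_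
    by_cases hy : y ∈ A
    · exact mul_le_mul_of_nonneg_left (ha y hy) (hq01 y).1
    · simp [hq, hy]
  have hla : m * a ≤ l * ∫ y in H, q y * ⟪y, θ⟫ ∂μ := by
    rw [← hlp, mul_assoc]; exact mul_le_mul_of_nonneg_left hqa hl0
  have hmz : m = 0 := by nlinarith
  have hfz : f =ᵐ[μ.restrict Hᶜ] 0 :=
    (integral_eq_zero_iff_of_nonneg (fun y => (f01 y).1) fi.restrict).1 hmz
  refine ⟨f, f01, fi.restrict, by linarith, fi2.restrict, ?_⟩
  rw [← integral_add_compl hH fi2]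
  have : ∫ y in Hᶜ, f y • y ∂μ = 0 := by
    rw [integral_eq_zero_of_ae]
    filter_upwards [hfz] with y hy
    simp [hy]
  rw [this, add_zero]

theorem low_aux {n : ℕ} {μ : Measure (EuclideanSpace ℝ (Fin n))} [IsFiniteMeasure μ]
    {e : EuclideanSpace ℝ (Fin n)} (he : ∀ᵐ y ∂μ, 0 ≤ ⟪y, e⟫) {s : ℝ} (hs : 0 < s)
    (hm : μ.real {y | ⟪y, e⟫ < s} ≤ 1 / 2)
    {z : EuclideanSpace ℝ (Fin n)} (hz : z ∈ metronoid μ) : s / 2 ≤ ⟪z, e⟫ := by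
  obtain ⟨f, f01, fi, f1, fi2, rfl⟩ := hz
  have hS : MeasurableSet {y : EuclideanSpace ℝ (Fin n) | ⟪y, e⟫ < s} :=
    (isOpen_lt (by fun_prop) continuous_const).measurableSet
  rw [inner_integral_aux fi2]
  have hi : Integrable ({y : EuclideanSpace ℝ (Fin n) | ⟪y, e⟫ < s}.indicator fun _ => (1:ℝ)) μ :=
    (integrable_const _).indicator hS
  have : ∫ y, s * (f y - {y : EuclideanSpace ℝ (Fin n) | ⟪y, e⟫ < s}.indicator (fun _ => (1:ℝ)) y) ∂μ
      ≤ ∫ y, f y * ⟪y, e⟫ ∂μ := by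
    refine integral_mono_ae ((fi.sub hi).const_mul s) (intg_inner_aux fi2 e) ?_
    filter_upwards [he] with y hy
    by_cases h : ⟪y, e⟫ < s
    · simp only [mem_ofPred_eq, h, indicator_of_mem]
      nlinarith [mul_nonneg (f01 y).1 hy, (f01 y).2]
    · simp only [mem_ofPred_eq, h, not_false_eq_true, indicator_of_notMem]
      nlinarith [mul_le_mul_of_nonneg_left (not_lt.1 h) (f01 y).1]
  refine le_trans ?_ this
  rw [integral_const_mul, integral_sub fi hi, f1, integral_indicator hS, setIntegral_const]
  simp only [smul_eq_mul, mul_one]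
  nlinarith

/-- Localization: if `0 ∈ ∂K` has unique outer unit normal `-eₙ`, then near `0` the
weighted Ulam floating body of `K` agrees with that of `K ∩ {⟨y,eₙ⟩ ≤ t}`. -/
theorem stmt19 (n : ℕ) (hn : 1 ≤ n) (K : Set (EuclideanSpace ℝ (Fin n)))
    (hK : IsCompact K) (hKc : Convex ℝ K) (hKi : (interior K).Nonempty)
    (h0 : (0 : EuclideanSpace ℝ (Fin n)) ∈ frontier K)
    (eN : EuclideanSpace ℝ (Fin n))
    (heN : eN = EuclideanSpace.single (⟨n - 1, by omega⟩ : Fin n) (1 : ℝ))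
    (hnormal : ∀ y ∈ K, ⟪y, -eN⟫ ≤ 0)
    (huniq : ∀ u : EuclideanSpace ℝ (Fin n), ‖u‖ = 1 →
      (∀ y ∈ K, ⟪y, u⟫ ≤ 0) → u = -eN)
    (φ : EuclideanSpace ℝ (Fin n) → ℝ) (hφpos : ∀ x ∈ K, 0 < φ x)
    (hφcont : ContinuousOn φ K) :
    ∀ t : ℝ, 0 < t → ∃ r : ℝ, 0 < r ∧ ∀ δ : ℝ, 0 < δ →
      ulamW K φ δ ∩ Metric.ball 0 r =
        ulamW (K ∩ {y | ⟪y, eN⟫ ≤ t}) φ δ ∩ Metric.ball 0 r := by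
  intro t ht
  have heN1 : ‖eN‖ = 1 := by rw [heN]; simp
  set H : Set (EuclideanSpace ℝ (Fin n)) := {y | ⟪y, eN⟫ ≤ t} with hHdef
  have hHm : MeasurableSet H := (isClosed_le (by fun_prop) continuous_const).measurableSet
  have hKm : MeasurableSet K := hK.isClosed.measurableSet
  have h0K : (0 : EuclideanSpace ℝ (Fin n)) ∈ K := hK.isClosed.frontier_subset h0
  have hKe : ∀ y ∈ K, 0 ≤ ⟪y, eN⟫ := by
    intro y hy
    have := hnormal y hy
    rw [inner_neg_right] at this; linarith
  have hKcl : K ⊆ closure (interior K) := by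
    rw [hKc.closure_interior_eq_closure_of_nonempty_interior hKi]; exact subset_closure
  obtain ⟨D, hDpos, hD⟩ : ∃ D : ℝ, 0 < D ∧ ∀ y ∈ K, ‖y‖ ≤ D := by
    obtain ⟨D, hD⟩ := hK.isBounded.exists_norm_le
    exact ⟨max D 1, by positivity, fun y hy => (hD y hy).trans (le_max_left _ _)⟩
  -- the measure
  have hφm : AEMeasurable (fun x => ENNReal.ofReal (φ x)) (volume.restrict K) :=
    (hφcont.aemeasurable hKm).ennreal_ofReal
  set ν : Measure (EuclideanSpace ℝ (Fin n)) :=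
    (volume.restrict K).withDensity fun x => ENNReal.ofReal (φ x) with hν
  have hνfin : IsFiniteMeasure ν :=
    isFiniteMeasure_withDensity_ofReal (hφcont.integrableOn_compact hK).2
  have hνac : ν ≪ volume :=
    (withDensity_absolutelyContinuous _ _).trans
      (Measure.absolutelyContinuous_of_le Measure.restrict_le_self)
  have hνK : ∀ᵐ y ∂ν, y ∈ K :=
    (withDensity_absolutelyContinuous _ _).ae_le (ae_restrict_mem hKm)
  have hνpos : ∀ U : Set (EuclideanSpace ℝ (Fin n)), IsOpen U → (U ∩ interior K).Nonempty →
      0 < ν.real (U ∩ interior K) := by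
    intro U hU hne
    have hVo : IsOpen (U ∩ interior K) := hU.inter isOpen_interior
    rw [measureReal_def, ENNReal.toReal_pos_iff]
    refine ⟨pos_iff_ne_zero.2 fun h => ?_, measure_lt_top _ _⟩
    rw [hν, withDensity_apply_eq_zero' hφm, Measure.restrict_apply₀'
      hKm.nullMeasurableSet] at h
    refine (hVo.measure_pos volume hne).ne' (measure_mono_null ?_ h)
    intro y hy
    have hyK := interior_subset hy.2
    exact ⟨⟨by simpa using hφpos y hyK, hy⟩, hyK⟩
  have hU1 : ∀ δ : ℝ, 0 < δ → ulamW K φ δ = metronoid (ENNReal.ofReal δ⁻¹ • ν) := by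
    intro δ hδ
    rw [ulamW, hν, ← withDensity_smul' _ _ ENNReal.ofReal_ne_top]
    congr 2
    ext1 x
    simp only [Pi.smul_apply, smul_eq_mul]
    rw [← ENNReal.ofReal_mul (by positivity)]
    congr 1; field_simp
  have hU2 : ∀ δ : ℝ, 0 < δ →
      ulamW (K ∩ H) φ δ = metronoid ((ENNReal.ofReal δ⁻¹ • ν).restrict H) := by
    intro δ hδ
    rw [ulamW, hν, ← withDensity_smul' _ _ ENNReal.ofReal_ne_top, restrict_withDensity hHm,
      Measure.restrict_restrict hHm, inter_comm H K]
    congr 2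
    ext1 x
    simp only [Pi.smul_apply, smul_eq_mul]
    rw [← ENNReal.ofReal_mul (by positivity)]
    congr 1; field_simp
  have hreal : ∀ δ : ℝ, 0 < δ → ∀ S, (ENNReal.ofReal δ⁻¹ • ν).real S = δ⁻¹ * ν.real S := by
    intro δ hδ S
    rw [measureReal_ennreal_smul_apply, ENNReal.toReal_ofReal (by positivity)]
  have hfin : ∀ δ : ℝ, IsFiniteMeasure (ENNReal.ofReal δ⁻¹ • ν) := fun δ =>
    Measure.smul_finite _ ENNReal.ofReal_ne_top
  have hμK : ∀ δ : ℝ, ∀ᵐ y ∂(ENNReal.ofReal δ⁻¹ • ν), y ∈ K := fun δ =>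
    (Measure.smul_absolutelyContinuous).ae_le hνK
  have hμD : ∀ δ : ℝ, ∀ᵐ y ∂(ENNReal.ofReal δ⁻¹ • ν), ‖y‖ ≤ D := fun δ =>
    (hμK δ).mono hD
  -- the uniform local statement
  let P : Set (EuclideanSpace ℝ (Fin n)) → Prop := fun S =>
    ∃ r : ℝ, 0 < r ∧ ∃ η : ℝ, 0 < η ∧ ∀ θ ∈ S, ‖θ‖ = 1 → ∀ δ : ℝ, 0 < δ → δ ≤ η →
      ∀ z ∈ metronoid (ENNReal.ofReal δ⁻¹ • ν), ‖z‖ < r →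
      (∀ w ∈ metronoid ((ENNReal.ofReal δ⁻¹ • ν).restrict H), ⟪w, θ⟫ ≤ ⟪z, θ⟫) →
      z ∈ metronoid ((ENNReal.ofReal δ⁻¹ • ν).restrict H)
  have hP : P (sphere 0 1) := by
    refine (isCompact_sphere _ _).induction_on (p := P) ?_ ?_ ?_ ?_
    · exact ⟨1, one_pos, 1, one_pos, by simp⟩
    · rintro S T hST ⟨r, hr, η, hη, h⟩
      exact ⟨r, hr, η, hη, fun θ hθ => h θ (hST hθ)⟩
    · rintro S T ⟨r, hr, η, hη, h⟩ ⟨r', hr', η', hη', h'⟩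
      refine ⟨min r r', by positivity, min η η', by positivity, ?_⟩
      rintro θ (hθ | hθ) h1 δ hδ hle z hz hzr
      · exact h θ hθ h1 δ hδ (hle.trans (min_le_left _ _)) z hz (hzr.trans_le (min_le_left _ _))
      · exact h' θ hθ h1 δ hδ (hle.trans (min_le_right _ _)) z hz
          (hzr.trans_le (min_le_right _ _))
    · intro θ₀ hθ₀
      have hθ₀1 : ‖θ₀‖ = 1 := by simpa using hθ₀
      have hinner : ∀ y ∈ K, ∀ θ : EuclideanSpace ℝ (Fin n), ∀ ε : ℝ, dist θ θ₀ < ε / D →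
          |⟪y, θ⟫ - ⟪y, θ₀⟫| ≤ ε := by
        intro y hy θ ε h
        rw [← inner_sub_right]
        refine (abs_real_inner_le_norm _ _).trans ?_
        rw [dist_eq_norm, lt_div_iff₀ hDpos] at h
        nlinarith [mul_le_mul_of_nonneg_right (hD y hy) (norm_nonneg (θ - θ₀))]
      by_cases hcase : θ₀ = -eN
      · -- near the normal direction
        have hne : ({y : EuclideanSpace ℝ (Fin n) | ⟪y, eN⟫ < t / 4} ∩ interior K).Nonempty := by
          refine mem_closure_iff.1 (hKcl h0K) _ (isOpen_lt (by fun_prop) continuous_const) ?_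
          simp [ht]
        have hUo : IsOpen {y : EuclideanSpace ℝ (Fin n) | ⟪y, eN⟫ < t / 4} :=
          isOpen_lt (by fun_prop) continuous_const
        have hpos := hνpos _ hUo hne
        set A := {y : EuclideanSpace ℝ (Fin n) | ⟪y, eN⟫ < t / 4} ∩ interior K with hA
        refine ⟨ball θ₀ (t / 4 / D), mem_nhdsWithin_of_mem_nhds (ball_mem_nhds _ (by positivity)),
          1, one_pos, ν.real A / 2, by positivity, ?_⟩
        intro θ hθ hθ1 δ hδ hle z hz hzr hmax
        have := hfin δ
        refine near_aux (A := A) (a := - (t / 2)) (b := - (3 * t / 4)) (θ := θ) (hμD δ) hHm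
          (hUo.inter isOpen_interior).measurableSet ?_ ?_ (by linarith) ?_ ?_ hz hmax
        · intro y hy
          have : ⟪y, eN⟫ < t / 4 := hy.1
          change ⟪y, eN⟫ ≤ t
          linarith
        · rw [hreal δ hδ, inv_mul_eq_div, le_div_iff₀ hδ]; linarith
        · intro y hy
          have h1 : ⟪y, eN⟫ < t / 4 := hy.1
          have h2 := abs_le.1 (hinner y (interior_subset hy.2) θ _ hθ)
          rw [hcase, inner_neg_right] at h2
          linarith [h2.1]
        · filter_upwards [ae_restrict_of_ae (hμK δ), ae_restrict_mem hHm.compl] with y hy hyH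
          have h1 : t < ⟪y, eN⟫ := not_le.1 hyH
          have h2 := abs_le.1 (hinner y hy θ _ hθ)
          rw [hcase, inner_neg_right] at h2
          linarith [h2.2]
      · -- away from the normal direction
        obtain ⟨y, hyK, hy⟩ : ∃ y ∈ K, 0 < ⟪y, θ₀⟫ := by
          by_contra! hcon
          exact hcase (huniq θ₀ hθ₀1 hcon)
        obtain ⟨x, hxK, hxt, hx⟩ : ∃ x ∈ K, ⟪x, eN⟫ < t ∧ 0 < ⟪x, θ₀⟫ := by
          have hs : 0 < t / (t + ⟪y, eN⟫) := div_pos ht (by linarith [hKe y hyK])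
          have hs1 : t / (t + ⟪y, eN⟫) ≤ 1 := by
            rw [div_le_one (by linarith [hKe y hyK])]; linarith [hKe y hyK]
          refine ⟨(t / (t + ⟪y, eN⟫)) • y, hKc.smul_mem_of_zero_mem h0K hyK ⟨hs.le, hs1⟩, ?_, ?_⟩
          · rw [real_inner_smul_left, div_mul_eq_mul_div, div_lt_iff₀ (by linarith [hKe y hyK])]
            nlinarith
          · rw [real_inner_smul_left]; positivity
        set c := ⟪x, θ₀⟫ / 4 with hc
        have hcpos : 0 < c := by positivity
        have hUo : IsOpen {y : EuclideanSpace ℝ (Fin n) | ⟪y, eN⟫ < t ∧ 2 * c < ⟪y, θ₀⟫} := by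
          have o1 : IsOpen {y : EuclideanSpace ℝ (Fin n) | ⟪y, eN⟫ < t} :=
            isOpen_lt (by fun_prop) continuous_const
          have o2 : IsOpen {y : EuclideanSpace ℝ (Fin n) | 2 * c < ⟪y, θ₀⟫} :=
            isOpen_lt continuous_const (by fun_prop)
          exact o1.inter o2
        have hne : ({y : EuclideanSpace ℝ (Fin n) | ⟪y, eN⟫ < t ∧ 2 * c < ⟪y, θ₀⟫} ∩
            interior K).Nonempty := by
          refine mem_closure_iff.1 (hKcl hxK) _ hUo ⟨hxt, ?_⟩
          linarith
        have hpos := hνpos _ hUo hne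
        set B := {y : EuclideanSpace ℝ (Fin n) | ⟪y, eN⟫ < t ∧ 2 * c < ⟪y, θ₀⟫} ∩
            interior K with hB
        refine ⟨ball θ₀ (c / D), mem_nhdsWithin_of_mem_nhds (ball_mem_nhds _ (by positivity)),
          c, hcpos, ν.real B, by positivity, ?_⟩
        intro θ hθ hθ1 δ hδ hle z hz hzr hmax
        have := hfin δ
        exfalso
        obtain ⟨w, hw, hcw⟩ := far_aux (H := H) (B := B) (θ := θ) (c := c) (hμD δ)
          (hUo.inter isOpen_interior).measurableSet (fun y hy => hy.1.1.le)
          (by rw [hreal δ hδ, inv_mul_eq_div, le_div_iff₀ hδ]; linarith)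
          (fun y hy => by
            have h1 : 2 * c < ⟪y, θ₀⟫ := hy.1.2
            have h2 := abs_le.1 (hinner y (interior_subset hy.2) θ _ hθ)
            linarith [h2.1])
        have h1 := hmax w hw
        have h2 := real_inner_le_norm z θ
        rw [hθ1, mul_one] at h2
        linarith
  obtain ⟨r, hr, η, hη, hmain⟩ := hP
  -- large δ
  obtain ⟨s, hs, hsν⟩ : ∃ s : ℝ, 0 < s ∧ ν.real {y | ⟪y, eN⟫ < s} < η / 2 := by
    have hlim := tendsto_measure_biInter_gt (μ := ν) (a := (0 : ℝ))
      (s := fun s : ℝ => {y : EuclideanSpace ℝ (Fin n) | ⟪y, eN⟫ < s})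
      (fun s _ => (isOpen_lt (by fun_prop) continuous_const).measurableSet.nullMeasurableSet)
      (fun i j _ hij y hy => lt_of_lt_of_le hy hij) ⟨1, one_pos, measure_ne_top _ _⟩
    have hzero : ν (⋂ s > (0 : ℝ), {y : EuclideanSpace ℝ (Fin n) | ⟪y, eN⟫ < s}) = 0 := by
      have hv : volume ((LinearMap.ker (innerSL ℝ eN).toLinearMap :
          Submodule ℝ (EuclideanSpace ℝ (Fin n))) : Set (EuclideanSpace ℝ (Fin n))) = 0 := by
        refine Measure.addHaar_submodule _ _ fun h => ?_
        have : eN ∈ LinearMap.ker (innerSL ℝ eN).toLinearMap := by rw [h]; trivial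
        have h3 : ⟪eN, eN⟫ = 0 := this
        rw [real_inner_self_eq_norm_sq, heN1] at h3
        norm_num at h3
      have hv2 : ∀ᵐ y ∂ν, ⟪y, eN⟫ ≠ 0 := by
        rw [ae_iff]
        refine measure_mono_null ?_ (hνac hv)
        intro y hy
        have h3 : ¬ (⟪y, eN⟫ ≠ 0) := hy
        change ⟪eN, y⟫ = 0
        rw [real_inner_comm]; exact not_not.1 h3
      rw [measure_eq_zero_iff_ae_notMem]
      filter_upwards [hv2, hνK] with y h1 h2 h3
      have h4 : ∀ s : ℝ, 0 < s → ⟪y, eN⟫ < s := fun s hs => mem_iInter₂.1 h3 s hs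
      exact h1 (le_antisymm (le_of_forall_gt fun s hs => h4 s hs) (hKe y h2))
    rw [hzero] at hlim
    have hev := (hlim.eventually (gt_mem_nhds (ENNReal.ofReal_pos.2 (half_pos hη)))).and
      self_mem_nhdsWithin
    obtain ⟨s, h1, h2⟩ := hev.exists
    refine ⟨s, h2, ?_⟩
    rw [measureReal_def]
    exact (ENNReal.lt_ofReal_iff_toReal_lt (measure_ne_top _ _)).1 h1
  refine ⟨min r (s / 2), by positivity, fun δ hδ => ?_⟩
  rw [hU1 δ hδ, hU2 δ hδ]
  have := hfin δ
  refine Subset.antisymm ?_ (inter_subset_inter_left _ (metronoid_restrict_subset _ hHm))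
  rintro z ⟨hz, hzb⟩
  refine ⟨?_, hzb⟩
  rw [mem_ball_zero_iff, lt_min_iff] at hzb
  rcases le_or_gt δ η with hle | hgt
  · by_contra hnot
    obtain ⟨θ, hθ, hsep⟩ := sep_aux hn (metronoid_convex _) hnot
    exact hnot (hmain θ (by simpa using hθ) hθ δ hδ hle z hz hzb.1 hsep)
  · exfalso
    have h1 := low_aux ((hμK δ).mono hKe) hs (by
      rw [hreal δ hδ, inv_mul_eq_div, div_le_iff₀ hδ]; linarith) hz
    have h2 := real_inner_le_norm z eN
    rw [heN1, mul_one] at h2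
    linarith [hzb.2]
end
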